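/- Let q ∈ ℂ be nonzero and not a root of unity, and let c₀, c₁, c̄₀, c̄₁, ε₀, ε₁ ∈ ℂ. Define A₀ = c₀ e₀ K₀ + c̄₀ f₀ K₀ + ε₀ K₀² and A₁ = c₁ e₁ K₁ + c̄₁ f₁ K₁ + ε₁ K₁². Then for both (i,j) = (0,1) and (i,j) = (1,0) one has A_i³A_j − [3]_q A_i²A_jA_i + [3]_q A_iA_jA_i² − A_jA_i³ = c_i c̄_i (q + q⁻¹)² (A_iA_j − A_jA_i), i.e. the elements A₀, A₁ satisfy the q-Dolan–Grady relations of the q-Onsager algebra with parameters ρ_i = c_i c̄_i (q + q⁻¹)², for arbitrary ε₀, ε₁. -/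

import Mathlib

/-- The relation `x³y - t x²yx + t xyx² - yx³ = ρ (xy - yx)`, which is the `q`-Serre relation
when `ρ = 0` and `t = [3]_q`, and the `q`-Dolan–Grady relation for general `ρ`. -/
def CubicRelation {A : Type*} [Ring A] [Algebra ℂ A] (t ρ : ℂ) (x y : A) : Prop :=
  x ^ 3 * y - t • (x ^ 2 * y * x) + t • (x * y * x ^ 2) - y * x ^ 3 = ρ • (x * y - y * x)

namespace CubicRelation

variable {A : Type*} [Ring A] [Algebra ℂ A] {t ρ : ℂ} {x y z : A}

theorem add (hy : CubicRelation t ρ x y) (hz : CubicRelation t ρ x z) :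
    CubicRelation t ρ x (y + z) := by
  unfold CubicRelation at *
  have h := congrArg₂ (· + ·) hy hz
  simp only [← smul_add] at h
  simp only [mul_add, add_mul, smul_add]
  convert h using 1
  · module
  · module

theorem smul (hy : CubicRelation t ρ x y) (a : ℂ) : CubicRelation t ρ x (a • y) := by
  have h := congrArg (a • ·) hy
  unfold CubicRelation
  simp only [mul_smul_comm, smul_mul_assoc, smul_sub, smul_add, smul_comm a] at h ⊢
  exact h

theorem mul_right (hy : CubicRelation t ρ x y) (hz : Commute z x) :
    CubicRelation t ρ x (y * z) := by
  have h := congrArg (· * z) hy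
  unfold CubicRelation
  simp only [sub_mul, add_mul, smul_mul_assoc, mul_assoc] at h
  simp only [mul_assoc, hz.eq, (hz.pow_right 2).eq, (hz.pow_right 3).eq]
  exact h

/-- Twisting by an invertible `k` that `q`-commutes with `x` and `q⁻¹`-commutes with `y`
preserves the `q`-Serre relation. -/
theorem twist {q : ℂ} (hq : q ≠ 0) {k m : A} (hkm : k * m = 1)
    (hkx : k * x = q • (x * k)) (hky : k * y = q⁻¹ • (y * k)) (hmx : m * x = q⁻¹ • (x * m))
    (hmk : m * k = 1) (h : CubicRelation t 0 x y) : CubicRelation t 0 (x * k) (y * m) := by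
  have hkx' (s : A) : k * (x * s) = q • (x * (k * s)) := by
    rw [← mul_assoc, hkx, smul_mul_assoc, mul_assoc]
  have hky' (s : A) : k * (y * s) = q⁻¹ • (y * (k * s)) := by
    rw [← mul_assoc, hky, smul_mul_assoc, mul_assoc]
  have hmx' (s : A) : m * (x * s) = q⁻¹ • (x * (m * s)) := by
    rw [← mul_assoc, hmx, smul_mul_assoc, mul_assoc]
  have hmk' (s : A) : m * (k * s) = s := by rw [← mul_assoc, hmk, one_mul]
  have h' := congrArg (· * (k * k)) h
  simp only [CubicRelation, zero_smul, pow_succ (_ : A), pow_zero (_ : A), one_mul, zero_mul,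
    sub_mul, add_mul, smul_mul_assoc, mul_smul_comm, mul_assoc, smul_smul, hkx', hky, hky', hmx', hkm,
    hmk, hmk', mul_one] at h' ⊢
  rw [← h']
  match_scalars <;> field_simp

end CubicRelation

/-- If `F` and `κ` `q⁻²`-commute with `y`, and `E`, `y` satisfy the cubic `q`-Serre relation,
then `a E + b F + ε κ` and `y` satisfy the `q`-Dolan–Grady relation. -/
theorem qDolanGrady_of_qSerre {A : Type*} [Ring A] [Algebra ℂ A] {q : ℂ} (hq : q ≠ 0)
    (hq2 : q ^ 2 - 1 ≠ 0) {E F κ y : A}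
    (hκE : κ * E = q ^ 2 • (E * κ)) (hκF : κ * F = (q ^ 2)⁻¹ • (F * κ))
    (hκy : κ * y = (q ^ 2)⁻¹ • (y * κ)) (hFy : F * y = (q ^ 2)⁻¹ • (y * F))
    (hFE : F * E = q ^ 2 • (E * F) - (q ^ 2 / (q ^ 2 - 1)) • (κ * κ - 1))
    (hS : CubicRelation (q ^ 2 + 1 + (q ^ 2)⁻¹) 0 E y)
    (a b ε : ℂ) {x : A} (hx : x = a • E + b • F + ε • κ) :
    CubicRelation (q ^ 2 + 1 + (q ^ 2)⁻¹) (a * b * (q + q⁻¹) ^ 2) x y := by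
  have hκE' (t : A) : κ * (E * t) = q ^ 2 • (E * (κ * t)) := by
    rw [← mul_assoc, hκE, smul_mul_assoc, mul_assoc]
  have hκF' (t : A) : κ * (F * t) = (q ^ 2)⁻¹ • (F * (κ * t)) := by
    rw [← mul_assoc, hκF, smul_mul_assoc, mul_assoc]
  have hκy' (t : A) : κ * (y * t) = (q ^ 2)⁻¹ • (y * (κ * t)) := by
    rw [← mul_assoc, hκy, smul_mul_assoc, mul_assoc]
  have hFy' (t : A) : F * (y * t) = (q ^ 2)⁻¹ • (y * (F * t)) := by
    rw [← mul_assoc, hFy, smul_mul_assoc, mul_assoc]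
  have hFE' (t : A) : F * (E * t)
      = q ^ 2 • (E * (F * t)) - (q ^ 2 / (q ^ 2 - 1)) • (κ * (κ * t) - t) := by
    rw [← mul_assoc, hFE]
    simp only [sub_mul, smul_mul_assoc, mul_assoc, one_mul]
  have hS' : E * (E * (E * y)) = (q ^ 2 + 1 + (q ^ 2)⁻¹) • (E * (E * (y * E)))
      - (q ^ 2 + 1 + (q ^ 2)⁻¹) • (E * (y * (E * E))) + y * (E * (E * E)) := by
    simp only [CubicRelation, zero_smul, pow_succ E, pow_zero, one_mul, mul_assoc] at hS
    rw [← sub_eq_zero, ← hS]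
    abel
  set u : A := E * y - (q ^ 2)⁻¹ • (y * E) with hu
  have hw : x * y - (q ^ 2)⁻¹ • (y * x) = a • u := by
    rw [hx, hu]
    simp only [mul_add, add_mul, smul_mul_assoc, mul_smul_comm, hκy, hFy]
    module
  have hfac : x ^ 3 * y - (q ^ 2 + 1 + (q ^ 2)⁻¹) • (x ^ 2 * y * x)
        + (q ^ 2 + 1 + (q ^ 2)⁻¹) • (x * y * x ^ 2) - y * x ^ 3
      = x * (x * (x * y - (q ^ 2)⁻¹ • (y * x)) - q ^ 2 • ((x * y - (q ^ 2)⁻¹ • (y * x)) * x))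
        - (x * (x * y - (q ^ 2)⁻¹ • (y * x)) - q ^ 2 • ((x * y - (q ^ 2)⁻¹ • (y * x)) * x)) * x := by
    simp only [pow_succ x, pow_zero, one_mul, mul_sub, sub_mul, smul_sub, smul_mul_assoc,
      mul_smul_comm, mul_assoc, smul_smul]
    match_scalars <;> field_simp <;> ring
  rw [CubicRelation, hfac, hw, hx, hu]
  simp only [mul_add, add_mul, mul_sub, sub_mul, smul_add, smul_sub, smul_mul_assoc,
    mul_smul_comm, mul_assoc, smul_smul, hκE, hκF, hκy, hFy, hFE, hκE', hκF', hκy', hFy', hFE',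
    hS', mul_one]
  match_scalars <;> field_simp <;> ring

/-- The `q`-Dolan–Grady relation for `a E + b F + ε κ` and an inverse `p` of `κ`. -/
theorem qDolanGrady_inv {A : Type*} [Ring A] [Algebra ℂ A] {q : ℂ} (hq : q ≠ 0)
    (hq2 : q ^ 2 - 1 ≠ 0) {E F κ p : A}
    (hκE : κ * E = q ^ 2 • (E * κ)) (hκF : κ * F = (q ^ 2)⁻¹ • (F * κ))
    (hκp : κ * p = 1) (hpκ : p * κ = 1)
    (hFE : F * E = q ^ 2 • (E * F) - (q ^ 2 / (q ^ 2 - 1)) • (κ * κ - 1))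
    (a b ε : ℂ) {x : A} (hx : x = a • E + b • F + ε • κ) :
    CubicRelation (q ^ 2 + 1 + (q ^ 2)⁻¹) (a * b * (q + q⁻¹) ^ 2) x p := by
  have hpE : p * E = (q ^ 2)⁻¹ • (E * p) := by
    have h : p * (κ * E) * p = q ^ 2 • (p * E * (κ * p)) := by
      rw [hκE]; simp only [smul_mul_assoc, mul_smul_comm, mul_assoc]
    rw [← mul_assoc, hpκ, one_mul, hκp, mul_one] at h
    rw [h, smul_smul, inv_mul_cancel₀ (pow_ne_zero 2 hq), one_smul]
  have hpF : p * F = q ^ 2 • (F * p) := by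
    have h : p * (κ * F) * p = (q ^ 2)⁻¹ • (p * F * (κ * p)) := by
      rw [hκF]; simp only [smul_mul_assoc, mul_smul_comm, mul_assoc]
    rw [← mul_assoc, hpκ, one_mul, hκp, mul_one] at h
    rw [h, smul_smul, mul_inv_cancel₀ (pow_ne_zero 2 hq), one_smul]
  have hκE' (t : A) : κ * (E * t) = q ^ 2 • (E * (κ * t)) := by
    rw [← mul_assoc, hκE, smul_mul_assoc, mul_assoc]
  have hκF' (t : A) : κ * (F * t) = (q ^ 2)⁻¹ • (F * (κ * t)) := by
    rw [← mul_assoc, hκF, smul_mul_assoc, mul_assoc]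
  have hpE' (t : A) : p * (E * t) = (q ^ 2)⁻¹ • (E * (p * t)) := by
    rw [← mul_assoc, hpE, smul_mul_assoc, mul_assoc]
  have hpF' (t : A) : p * (F * t) = q ^ 2 • (F * (p * t)) := by
    rw [← mul_assoc, hpF, smul_mul_assoc, mul_assoc]
  have hpκ' (t : A) : p * (κ * t) = t := by rw [← mul_assoc, hpκ, one_mul]
  have hFE' (t : A) : F * (E * t)
      = q ^ 2 • (E * (F * t)) - (q ^ 2 / (q ^ 2 - 1)) • (κ * (κ * t) - t) := by
    rw [← mul_assoc, hFE]
    simp only [sub_mul, smul_mul_assoc, mul_assoc, one_mul]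
  rw [CubicRelation, hx]
  simp only [pow_succ (_ : A), pow_zero (_ : A), mul_add, add_mul, mul_sub, sub_mul, smul_add,
    smul_sub, smul_mul_assoc, mul_smul_comm, mul_assoc, smul_smul, hκE, hκF, hpE, hpF, hFE,
    hκE', hκF', hpE', hpF', hFE', hκp, hpκ, hpκ', mul_one, one_mul]
  match_scalars <;> field_simp <;> ring

theorem sq_mul_eq_smul {A : Type*} [Ring A] [Algebra ℂ A] {k x : A} {r : ℂ}
    (h : k * x = r • (x * k)) : k * k * x = r ^ 2 • (x * (k * k)) := by
  rw [mul_assoc, h, mul_smul_comm, ← mul_assoc, h, smul_mul_assoc, smul_smul, mul_assoc, pow_two]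

theorem mul_right_eq_smul {A : Type*} [Ring A] [Algebra ℂ A] {k x m : A} {r : ℂ}
    (h : k * x = r • (x * k)) (hkm : Commute k m) : k * (x * m) = r • (x * m * k) := by
  rw [← mul_assoc, h, smul_mul_assoc, mul_assoc, hkm.eq, mul_assoc]

theorem Units.mul_eq_smul_of_conj {A : Type*} [Ring A] [Algebra ℂ A] {k : Aˣ} {x : A} {r : ℂ}
    (h : (k : A) * x * ((k⁻¹ : Aˣ) : A) = r • x) : (k : A) * x = r • (x * k) := by
  rw [← smul_mul_assoc, ← h, Units.inv_mul_cancel_right]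

theorem Units.inv_mul_eq_smul {A : Type*} [Ring A] [Algebra ℂ A] {k : Aˣ} {x : A} {r : ℂ}
    (hr : r ≠ 0) (h : (k : A) * x = r • (x * k)) :
    ((k⁻¹ : Aˣ) : A) * x = r⁻¹ • (x * ((k⁻¹ : Aˣ) : A)) := by
  rw [Units.inv_mul_eq_iff_eq_mul, mul_smul_comm, ← mul_assoc, h, smul_mul_assoc, smul_smul,
    inv_mul_cancel₀ hr, one_smul, Units.mul_inv_cancel_right]

theorem mul_commute_of_smul {A : Type*} [Ring A] [Algebra ℂ A] {k l x : A} {r s : ℂ}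
    (hrs : r * s = 1) (hk : k * x = r • (x * k)) (hl : l * x = s • (x * l)) :
    Commute (k * l) x := by
  rw [Commute, SemiconjBy, mul_assoc, hl, mul_smul_comm, ← mul_assoc, hk, smul_mul_assoc,
    smul_smul, mul_comm s, hrs, one_smul, mul_assoc]

/-- In the level-zero `U_q(sl₂-hat)` setting, the elements
`A_i = c_i e_i K_i + c̄_i f_i K_i + ε_i K_i²` satisfy the q-Dolan–Grady relations
with parameters `ρ_i = c_i c̄_i (q + q⁻¹)²`, for arbitrary `ε₀, ε₁`. -/
theorem stmt_0 (q : ℂ) (hq0 : q ≠ 0) (hqroot : ∀ n : ℕ, 0 < n → q ^ n ≠ 1)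
    (A : Type*) [Ring A] [Algebra ℂ A]
    (e f : Fin 2 → A) (K : Fin 2 → Aˣ)
    (hKcomm : (K 0 : A) * (K 1 : A) = (K 1 : A) * (K 0 : A))
    (hKeK : ∀ i, (K i : A) * e i * (((K i)⁻¹ : Aˣ) : A) = q • e i)
    (hKfK : ∀ i, (K i : A) * f i * (((K i)⁻¹ : Aˣ) : A) = q⁻¹ • f i)
    (hKeK' : ∀ i j, i ≠ j → (K i : A) * e j * (((K i)⁻¹ : Aˣ) : A) = q⁻¹ • e j)
    (hKfK' : ∀ i j, i ≠ j → (K i : A) * f j * (((K i)⁻¹ : Aˣ) : A) = q • f j)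
    (hef : ∀ i, e i * f i - f i * e i
      = (q - q⁻¹)⁻¹ • ((K i : A) ^ 2 - (((K i)⁻¹ : Aˣ) : A) ^ 2))
    (hef' : ∀ i j, i ≠ j → e i * f j = f j * e i)
    (hSerre_e : ∀ i j, i ≠ j →
      e i ^ 3 * e j - (q ^ 2 + 1 + (q ^ 2)⁻¹) • (e i ^ 2 * e j * e i)
        + (q ^ 2 + 1 + (q ^ 2)⁻¹) • (e i * e j * e i ^ 2) - e j * e i ^ 3 = 0)
    (hSerre_f : ∀ i j, i ≠ j →
      f i ^ 3 * f j - (q ^ 2 + 1 + (q ^ 2)⁻¹) • (f i ^ 2 * f j * f i)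
        + (q ^ 2 + 1 + (q ^ 2)⁻¹) • (f i * f j * f i ^ 2) - f j * f i ^ 3 = 0)
    (c cb ε : Fin 2 → ℂ)
    (X : Fin 2 → A)
    (hX : ∀ i, X i = c i • (e i * (K i : A)) + cb i • (f i * (K i : A))
      + ε i • ((K i : A) ^ 2)) :
    ∀ i j, i ≠ j →
      X i ^ 3 * X j - (q ^ 2 + 1 + (q ^ 2)⁻¹) • (X i ^ 2 * X j * X i)
        + (q ^ 2 + 1 + (q ^ 2)⁻¹) • (X i * X j * X i ^ 2) - X j * X i ^ 3
      = (c i * cb i * (q + q⁻¹) ^ 2) • (X i * X j - X j * X i) := by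
  intro i j hij
  have hq2 : q ^ 2 - 1 ≠ 0 := sub_ne_zero.2 (hqroot 2 two_pos)
  have hqi : q⁻¹ ≠ 0 := inv_ne_zero hq0
  have hqi2 : q⁻¹ ^ 2 - 1 ≠ 0 := by
    rw [inv_pow]
    exact sub_ne_zero.2 (inv_ne_one.2 (hqroot 2 two_pos))
  have hkl : Commute (K i : A) (K j : A) := by
    fin_cases i <;> fin_cases j
    exacts [Commute.refl _, hKcomm, hKcomm.symm, Commute.refl _]
  have hke := Units.mul_eq_smul_of_conj (hKeK i)
  have hkf := Units.mul_eq_smul_of_conj (hKfK i)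
  have hke' := Units.mul_eq_smul_of_conj (hKeK' i j hij)
  have hkf' := Units.mul_eq_smul_of_conj (hKfK' i j hij)
  have hme := Units.inv_mul_eq_smul hq0 hke
  have hmf := Units.inv_mul_eq_smul hqi hkf
  have hze := mul_commute_of_smul (mul_inv_cancel₀ hq0) hke
    (Units.mul_eq_smul_of_conj (hKeK' j i hij.symm))
  have hzf := mul_commute_of_smul (inv_mul_cancel₀ hq0) hkf
    (Units.mul_eq_smul_of_conj (hKfK' j i hij.symm))
  have hzk : Commute ((K i : A) * K j) (K i) := (Commute.refl _).mul_left hkl.symm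
  have hefi := hef i
  have hef₁ := hef' i j hij
  have hef₂ := hef' j i hij.symm
  have hSe : CubicRelation (q ^ 2 + 1 + (q ^ 2)⁻¹) 0 (e i) (e j) := by
    simpa only [CubicRelation, zero_smul] using hSerre_e i j hij
  have hSf : CubicRelation (q ^ 2 + 1 + (q ^ 2)⁻¹) 0 (f i) (f j) := by
    simpa only [CubicRelation, zero_smul] using hSerre_f i j hij
  have hXi : X i = c i • (e i * (K i : A)) + cb i • (f i * (K i : A))
      + ε i • ((K i : A) * K i) := by rw [hX, pow_two]
  have hzX : Commute ((K i : A) * K j) (X i) := by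
    rw [hXi]
    exact (((hze.mul_right hzk).smul_right _).add_right
      ((hzf.mul_right hzk).smul_right _)).add_right ((hzk.mul_right hzk).smul_right _)
  have hkm : (K i : A) * ((K i)⁻¹ : Aˣ) = 1 := Units.mul_inv _
  have hmk : (((K i)⁻¹ : Aˣ) : A) * K i = 1 := Units.inv_mul _
  have hl : (K j : A) = (((K i)⁻¹ : Aˣ) : A) * (K i * K j) := by
    rw [Units.inv_mul_cancel_left]
  have hl2 : (K j : A) ^ 2 =
      (((K i)⁻¹ : Aˣ) : A) * ((K i)⁻¹ : Aˣ) * (K i * K j) * (K i * K j) := by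
    rw [mul_assoc _ (((K i)⁻¹ : Aˣ) : A), ← hl, hkl.eq, ← mul_assoc,
      mul_assoc _ (K j : A) (K j : A), (hkl.symm.mul_left hkl.symm).units_inv_right.symm.eq,
      Units.inv_mul_cancel_right, pow_two]
  generalize hz : (K i : A) * K j = z at *
  generalize hk : (K i : A) = k at *
  generalize hm : (((K i)⁻¹ : Aˣ) : A) = m at *
  have hcomm : Commute k m := hkm.trans hmk.symm
  have hcommkk : Commute k k := Commute.refl k
  have hEF : f i * k * (e i * k) = q ^ 2 • (e i * k * (f i * k))
      - (q ^ 2 / (q ^ 2 - 1)) • (k * k * (k * k) - 1) := by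
    have h : e i * f i * (k * k) - f i * e i * (k * k)
        = (q - q⁻¹)⁻¹ • (k * k * (k * k) - 1) := by
      rw [← sub_mul, hefi, smul_mul_assoc, sub_mul, pow_two, pow_two, mul_assoc m m,
        ← mul_assoc m k k, hmk, one_mul, hmk]
    have hfe : f i * k * (e i * k) = q • (f i * e i * (k * k)) := by
      rw [mul_assoc, ← mul_assoc k, hke, smul_mul_assoc, mul_smul_comm]
      simp only [mul_assoc]
    have hef : e i * k * (f i * k) = q⁻¹ • (e i * f i * (k * k)) := by
      rw [mul_assoc, ← mul_assoc k, hkf, smul_mul_assoc, mul_smul_comm]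
      simp only [mul_assoc]
    rw [hfe, hef, sub_eq_iff_eq_add.1 h]
    match_scalars <;> field_simp <;> ring
  have hFE : e i * k * (f i * k) = q⁻¹ ^ 2 • (f i * k * (e i * k))
      - (q⁻¹ ^ 2 / (q⁻¹ ^ 2 - 1)) • (k * k * (k * k) - 1) := by
    rw [hEF]
    match_scalars <;> grind
  have hκE := sq_mul_eq_smul (mul_right_eq_smul hke hcommkk)
  have hκF := sq_mul_eq_smul (mul_right_eq_smul hkf hcommkk)
  have hκe := sq_mul_eq_smul (mul_right_eq_smul hke' hcomm)
  have hκf := sq_mul_eq_smul (mul_right_eq_smul hkf' hcomm)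
  have hFe : f i * k * (e j * m) = (q ^ 2)⁻¹ • (e j * m * (f i * k)) := by
    rw [mul_assoc, ← mul_assoc k, hke', mul_assoc (e j), ← mul_assoc m, hmf]
    simp only [smul_mul_assoc, mul_smul_comm, mul_assoc, hkm, hmk, mul_one, smul_smul, hef₂]
    congr 1
    field_simp
  have hEf : e i * k * (f j * m) = (q⁻¹ ^ 2)⁻¹ • (f j * m * (e i * k)) := by
    rw [mul_assoc, ← mul_assoc k, hkf', mul_assoc (f j), ← mul_assoc m, hme]
    simp only [smul_mul_assoc, mul_smul_comm, mul_assoc, hkm, hmk, mul_one, smul_smul, hef₁]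
    congr 1
    field_simp
  have hDe : CubicRelation _ _ (X i) (e j * m) :=
    qDolanGrady_of_qSerre hq0 hq2 hκE (by simpa using hκF) (by simpa using hκe) hFe hEF
      (hSe.twist hq0 hkm hke hke' hme hmk) (c i) (cb i) (ε i) hXi
  have hDf : CubicRelation _ _ (X i) (f j * m) :=
    qDolanGrady_of_qSerre hqi hqi2 hκF (by simpa using hκE) (by simpa using hκf) hEf hFE
      (by
        have := hSf.twist hqi hkm hkf (by simpa using hkf') hmf hmk
        convert this using 1
        grind) (cb i) (c i) (ε i)
      (by rw [hXi, add_comm (c i • (e i * k))])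
  have hDk : CubicRelation _ _ (X i) (m * m) :=
    qDolanGrady_inv hq0 hq2 hκE (by simpa using hκF)
      (by rw [mul_assoc, ← mul_assoc k m m, hkm, one_mul, hkm])
      (by rw [mul_assoc, ← mul_assoc m k k, hmk, one_mul, hmk]) hEF (c i) (cb i) (ε i) hXi
  have hDf' : CubicRelation (q ^ 2 + 1 + (q ^ 2)⁻¹) (c i * cb i * (q + q⁻¹) ^ 2)
      (X i) (f j * m) := by
    convert hDf using 1 <;> grind
  have hXj : X j = c j • (e j * m * z) + cb j • (f j * m * z) + ε j • (m * m * z * z) := by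
    rw [hX, hl2, hl, mul_assoc (e j), mul_assoc (f j)]
  rw [hXj]
  exact (((hDe.mul_right hzX).smul _).add ((hDf'.mul_right hzX).smul _)).add
    (((hDk.mul_right hzX).mul_right hzX).smul _)
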